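/- Let a<b be real, let p ∈ ]1,+∞[, and let ψ : ℝ → ]0,+∞[ be a bounded Borel function with ∫_{−∞}^{+∞} ψ(t)^{1/p} dt < +∞ and inf_K ψ > 0 for every compact K ⊂ ℝ. Let g be Lipschitz continuous on [a,b] and let {u_n} ⊂ X^p_ψ(]a,b[) satisfy sup_n F̄_p(u_n) < +∞ and u_n → g in L²(]a,b[). Then g ∈ C¹([a,b]) ∩ X^p_ψ(]a,b[), u_n ∈ C¹([a,b]) for n large enough, and u_n → g in C¹([a,b]). -/

import Mathlib

open MeasureTheory Filter Set Topology
open scoped ENNReal NNReal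

noncomputable section

/-- `Ψ₁(t) = ∫_{-∞}^t ψ(s) ds`. -/
def Psi1 (ψ : ℝ → ℝ) (t : ℝ) : ℝ := ∫ s in Set.Iic t, ψ s

/-- `Ψ_p(t) = ∫_{-∞}^t ψ(s)^{1/p} ds`. -/
def Psip (ψ : ℝ → ℝ) (p t : ℝ) : ℝ := ∫ s in Set.Iic t, ψ s ^ (1 / p)

/-- The natural extension of `Ψ₁` to the extended reals:
`Ψ₁(-∞) = 0`, `Ψ₁(+∞) = ∫_ℝ ψ`. -/
def Psi1E (ψ : ℝ → ℝ) (t : EReal) : ℝ :=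
  if t = ⊤ then ∫ s, ψ s else if t = ⊥ then 0 else Psi1 ψ t.toReal

/-- Standing assumptions on `ψ` in the case `p = 1`: a bounded, everywhere positive
Borel function, integrable on `ℝ`, whose infimum on every compact set is positive. -/
structure PsiHyp (ψ : ℝ → ℝ) : Prop where
  measurable : Measurable ψ
  pos : ∀ t, 0 < ψ t
  bounded : ∃ C, ∀ t, ψ t ≤ C
  integrable : MeasureTheory.Integrable ψ
  inf_pos : ∀ K : Set ℝ, IsCompact K → ∃ δ > 0, ∀ t ∈ K, δ ≤ ψ t

/-- Standing assumptions on `ψ` in the case `p > 1`: as in `PsiHyp` but with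
`ψ^{1/p}` integrable on `ℝ`. -/
structure PsiHypP (ψ : ℝ → ℝ) (p : ℝ) : Prop where
  measurable : Measurable ψ
  pos : ∀ t, 0 < ψ t
  bounded : ∃ C, ∀ t, ψ t ≤ C
  integrable : MeasureTheory.Integrable fun t => ψ t ^ (1 / p)
  inf_pos : ∀ K : Set ℝ, IsCompact K → ∃ δ > 0, ∀ t ∈ K, δ ≤ ψ t

/-- `(μp, μn)` is the Jordan decomposition of the distributional derivative of
`u ∈ L¹(]a,b[)`; the existence of such a pair encodes `u ∈ BV(]a,b[)`,
and `μp + μn` is the total variation measure `|u'|`. -/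
def IsDerivMeasures (a b : ℝ) (u : ℝ → ℝ) (μp μn : Measure ℝ) : Prop :=
  MeasureTheory.IntegrableOn u (Set.Ioo a b) ∧
  IsFiniteMeasure μp ∧ IsFiniteMeasure μn ∧ μp ⟂ₘ μn ∧
  μp (Set.Ioo a b)ᶜ = 0 ∧ μn (Set.Ioo a b)ᶜ = 0 ∧
  ∀ φ : ℝ → ℝ, ContDiff ℝ 1 φ → tsupport φ ⊆ Set.Ioo a b →
    ∫ x in Set.Ioo a b, u x * deriv φ x = (∫ x, φ x ∂μn) - ∫ x, φ x ∂μp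

/-- The density `(u')^a` of the absolutely continuous part of the derivative whose
Jordan decomposition is `(μp, μn)`. -/
def uaD (μp μn : Measure ℝ) (x : ℝ) : ℝ :=
  (μp.rnDeriv MeasureTheory.volume x).toReal - (μn.rnDeriv MeasureTheory.volume x).toReal

/-- Left approximate limit `u₋(y) = lim_{ε→0⁺} ε⁻¹ ∫_{y-ε}^y u`. -/
def leftApproxLim (u : ℝ → ℝ) (y : ℝ) : ℝ :=
  limUnder (𝓝[>] (0 : ℝ)) fun ε => (∫ x in Set.Ioo (y - ε) y, u x) / ε

/-- Right approximate limit `u₊(y) = lim_{ε→0⁺} ε⁻¹ ∫_y^{y+ε} u`. -/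
def rightApproxLim (u : ℝ → ℝ) (y : ℝ) : ℝ :=
  limUnder (𝓝[>] (0 : ℝ)) fun ε => (∫ x in Set.Ioo y (y + ε), u x) / ε

/-- Left approximate limit computed in the extended reals (may be `±∞`). -/
def leftApproxLimE (u : ℝ → ℝ) (y : ℝ) : EReal :=
  limUnder (𝓝[>] (0 : ℝ)) fun ε => (((∫ x in Set.Ioo (y - ε) y, u x) / ε : ℝ) : EReal)

/-- Right approximate limit computed in the extended reals (may be `±∞`). -/
def rightApproxLimE (u : ℝ → ℝ) (y : ℝ) : EReal :=
  limUnder (𝓝[>] (0 : ℝ)) fun ε => (((∫ x in Set.Ioo y (y + ε), u x) / ε : ℝ) : EReal)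

/-- The jump set `S_u` of `u` in `]a,b[`. -/
def jumpSet (a b : ℝ) (u : ℝ → ℝ) : Set ℝ :=
  {y | y ∈ Set.Ioo a b ∧ leftApproxLim u y ≠ rightApproxLim u y}

/-- `ν_u = sign(u₊ - u₋)`. -/
def jumpSign (u : ℝ → ℝ) (y : ℝ) : ℝ :=
  Real.sign (rightApproxLim u y - leftApproxLim u y)

/-- `Z⁺[w] = {x ∈ ]a,b[ : lim_{ε→0⁺} (2ε)⁻¹∫_{x-ε}^{x+ε} w = +∞}`. -/
def ZPlus (a b : ℝ) (w : ℝ → ℝ) : Set ℝ :=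
  {x | x ∈ Set.Ioo a b ∧
    Tendsto (fun ε => (∫ t in Set.Ioo (x - ε) (x + ε), w t) / (2 * ε)) (𝓝[>] (0 : ℝ)) atTop}

/-- `Z⁻[w] = {x ∈ ]a,b[ : lim_{ε→0⁺} (2ε)⁻¹∫_{x-ε}^{x+ε} w = -∞}`. -/
def ZMinus (a b : ℝ) (w : ℝ → ℝ) : Set ℝ :=
  {x | x ∈ Set.Ioo a b ∧
    Tendsto (fun ε => (∫ t in Set.Ioo (x - ε) (x + ε), w t) / (2 * ε)) (𝓝[>] (0 : ℝ)) atBot}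

/-- The positive part `((u')^c)⁺` of the Cantor part of the derivative of `u`:
the singular part of `μp` with the atoms on the jump set removed. -/
def cantorPos (a b : ℝ) (u : ℝ → ℝ) (μp : Measure ℝ) : Measure ℝ :=
  (μp.singularPart MeasureTheory.volume).restrict (jumpSet a b u)ᶜ

/-- The negative part `((u')^c)⁻` of the Cantor part of the derivative of `u`. -/
def cantorNeg (a b : ℝ) (u : ℝ → ℝ) (μn : Measure ℝ) : Measure ℝ :=
  (μn.singularPart MeasureTheory.volume).restrict (jumpSet a b u)ᶜ

/-- `u ∈ X¹_ψ(]a,b[)`, with derivative data `(μp, μn)`:  `u ∈ BV(]a,b[)`,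
`Ψ₁∘(u')^a ∈ BV(]a,b[)`, and `((u')^c)^±` is concentrated on `Z^±[(u')^a]`. -/
def MemX1 (ψ : ℝ → ℝ) (a b : ℝ) (u : ℝ → ℝ) (μp μn : Measure ℝ) : Prop :=
  IsDerivMeasures a b u μp μn ∧
  (∃ νp νn : Measure ℝ, IsDerivMeasures a b (fun x => Psi1 ψ (uaD μp μn x)) νp νn) ∧
  cantorPos a b u μp (ZPlus a b (uaD μp μn))ᶜ = 0 ∧
  cantorNeg a b u μn (ZMinus a b (uaD μp μn))ᶜ = 0

/-- `f ∈ W^{1,p}(]a,b[)`: `f` has an absolutely continuous representative whose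
pointwise a.e. derivative lies in `L^p(]a,b[)`. -/
def MemW1pOn (p a b : ℝ) (f : ℝ → ℝ) : Prop :=
  ∃ g w : ℝ → ℝ,
    (∀ᵐ x ∂(MeasureTheory.volume.restrict (Set.Ioo a b)), g x = f x) ∧
    MeasureTheory.IntegrableOn w (Set.Ioo a b) ∧
    MeasureTheory.IntegrableOn (fun x => |w x| ^ p) (Set.Ioo a b) ∧
    ∀ x ∈ Set.Ioo a b, ∀ y ∈ Set.Ioo a b, g y - g x = ∫ t in x..y, w t

/-- `u ∈ X^p_ψ(]a,b[)`, with derivative data `(μp, μn)`:  `u ∈ BV(]a,b[)`,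
`Ψ_p∘(u')^a ∈ W^{1,p}(]a,b[)`, and `((u')^s)^±` is concentrated on `Z^±[(u')^a]`. -/
def MemXp (ψ : ℝ → ℝ) (p a b : ℝ) (u : ℝ → ℝ) (μp μn : Measure ℝ) : Prop :=
  IsDerivMeasures a b u μp μn ∧
  MemW1pOn p a b (fun x => Psip ψ p (uaD μp μn x)) ∧
  (μp.singularPart MeasureTheory.volume) (ZPlus a b (uaD μp μn))ᶜ = 0 ∧
  (μn.singularPart MeasureTheory.volume) (ZMinus a b (uaD μp μn))ᶜ = 0

/-- `u ∈ W^{2,p}(]a,b[)` with first derivative `v` and second derivative `w`. -/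
def W2pRep (p a b : ℝ) (u v w : ℝ → ℝ) : Prop :=
  (∀ x ∈ Set.Ioo a b, HasDerivAt u (v x) x) ∧
  (∀ x ∈ Set.Ioo a b, ∀ y ∈ Set.Ioo a b, v y - v x = ∫ t in x..y, w t) ∧
  MeasureTheory.IntegrableOn u (Set.Ioo a b) ∧
  MeasureTheory.IntegrableOn v (Set.Ioo a b) ∧
  MeasureTheory.IntegrableOn w (Set.Ioo a b) ∧
  MeasureTheory.IntegrableOn (fun x => |w x| ^ p) (Set.Ioo a b)

/-- The functional `F_p(u) = ∫_a^b |u'| + ∫_a^b ψ(u')|u''|^p` if `u ∈ W^{2,p}(]a,b[)`,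
`+∞` otherwise (as an infimum over Sobolev representations). -/
def Fp (ψ : ℝ → ℝ) (p a b : ℝ) (u : ℝ → ℝ) : ℝ≥0∞ :=
  ⨅ (v : ℝ → ℝ) (w : ℝ → ℝ) (_ : W2pRep p a b u v w),
    ENNReal.ofReal ((∫ x in Set.Ioo a b, |v x|) + ∫ x in Set.Ioo a b, ψ (v x) * |w x| ^ p)

/-- Strong `L¹(]a,b[)` convergence of a sequence. -/
def TendstoL1 (a b : ℝ) (U : ℕ → ℝ → ℝ) (u : ℝ → ℝ) : Prop :=
  (∀ k, MeasureTheory.IntegrableOn (U k) (Set.Ioo a b)) ∧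
  MeasureTheory.IntegrableOn u (Set.Ioo a b) ∧
  Tendsto (fun k => ∫ x in Set.Ioo a b, |U k x - u x|) atTop (𝓝 0)

/-- The relaxed functional
`F̄_p(u) = inf { liminf_k F_p(u_k) : u_k → u in L¹(]a,b[) }`. -/
def FpRel (ψ : ℝ → ℝ) (p a b : ℝ) (u : ℝ → ℝ) : ℝ≥0∞ :=
  ⨅ (U : ℕ → ℝ → ℝ) (_ : TendstoL1 a b U u),
    liminf (fun k => Fp ψ p a b (U k)) atTop

/-- `Φ(s, t₁, t₂)` of the relaxation formula (`s` being the sign of the jump). -/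
def Phi (ψ : ℝ → ℝ) (s : ℝ) (t₁ t₂ : EReal) : ℝ :=
  if 0 < s then ((∫ t, ψ t) - Psi1E ψ t₁) + ((∫ t, ψ t) - Psi1E ψ t₂)
  else Psi1E ψ t₁ + Psi1E ψ t₂

/-- `Φ̂(s, t₁, t₂)` of Remark 2.5. -/
def PhiHat (ψ : ℝ → ℝ) (s : ℝ) (t₁ t₂ : EReal) : ℝ :=
  if 0 < s then (∫ t, ψ t) - Psi1E ψ (max t₁ t₂)
  else Psi1E ψ (min t₁ t₂)

/-- `ubar` is a `C¹([a,b])` representative of `u`. -/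
def C1Rep (a b : ℝ) (u ubar : ℝ → ℝ) : Prop :=
  (∀ᵐ x ∂(MeasureTheory.volume.restrict (Set.Ioo a b)), ubar x = u x) ∧
  ContDiffOn ℝ 1 ubar (Set.Icc a b)

/-- `u` solves `min { F̄₁(w) + λ ∫_a^b (w - G)² : w ∈ X¹_ψ(]a,b[) }`. -/
def IsSolution1 (ψ : ℝ → ℝ) (a b lam : ℝ) (G u : ℝ → ℝ) : Prop :=
  (∃ μp μn : Measure ℝ, MemX1 ψ a b u μp μn) ∧
  ∀ w : ℝ → ℝ, (∃ ηp ηn : Measure ℝ, MemX1 ψ a b w ηp ηn) →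
    FpRel ψ 1 a b u + ENNReal.ofReal (lam * ∫ x in Set.Ioo a b, (u x - G x) ^ 2) ≤
    FpRel ψ 1 a b w + ENNReal.ofReal (lam * ∫ x in Set.Ioo a b, (w x - G x) ^ 2)

/-- `u` solves `min { F̄_p(w) + λ ∫_a^b |w - G|² : w ∈ X^p_ψ(]a,b[) }`. -/
def IsSolutionP (ψ : ℝ → ℝ) (p a b lam : ℝ) (G u : ℝ → ℝ) : Prop :=
  (∃ μp μn : Measure ℝ, MemXp ψ p a b u μp μn) ∧
  ∀ w : ℝ → ℝ, (∃ ηp ηn : Measure ℝ, MemXp ψ p a b w ηp ηn) →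
    FpRel ψ p a b u + ENNReal.ofReal (lam * ∫ x in Set.Ioo a b, (u x - G x) ^ 2) ≤
    FpRel ψ p a b w + ENNReal.ofReal (lam * ∫ x in Set.Ioo a b, (w x - G x) ^ 2)

/-- The Rudin–Osher–Fatemi energy `|w'|(]a,b[) + λ∫_a^b (w-g)²`, where `(ηp, ηn)`
is the Jordan decomposition of the derivative of `w`. -/
def ROFenergy (a b lam : ℝ) (g w : ℝ → ℝ) (ηp ηn : Measure ℝ) : ℝ≥0∞ :=
  (ηp + ηn) (Set.Ioo a b) + ENNReal.ofReal (lam * ∫ x in Set.Ioo a b, (w x - g x) ^ 2)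

/-- The left-continuous generalized inverse `g^{-1}(c) = inf {x ∈ [a,b] : g(x) ≥ c}`. -/
def gInv (a b : ℝ) (g : ℝ → ℝ) (c : ℝ) : ℝ :=
  sInf {x | x ∈ Set.Icc a b ∧ c ≤ g x}

end

noncomputable section
open MeasureTheory Filter Set Topology
open scoped ENNReal NNReal

/-- Jensen's inequality for the power `p` of an interval integral. -/
lemma abs_intervalIntegral_rpow_le {p x y : ℝ} (hp : 1 < p) (hxy : x ≤ y) {w : ℝ → ℝ}
    (hw : IntervalIntegrable w volume x y)
    (hwp : IntervalIntegrable (fun t => |w t| ^ p) volume x y) :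
    |∫ t in x..y, w t| ^ p ≤ (y - x) ^ (p - 1) * ∫ t in x..y, |w t| ^ p := by
  rcases hxy.eq_or_lt with rfl | hlt
  · simp [Real.zero_rpow (by linarith : p ≠ 0)]
  have hpos : 0 < y - x := sub_pos.2 hlt
  have hvol : volume.real (Ioc x y) = y - x := by simp [hxy]
  have hJ := (convexOn_rpow hp.le).map_set_average_le
    (f := fun t => |w t|) (μ := volume) (t := Ioc x y)
    (Real.continuous_rpow_const (by linarith)).continuousOn isClosed_Ici (by simp [hlt])
    (by simp) (by simp) hw.1.abs hwp.1
  rw [setAverage_eq, setAverage_eq, hvol, smul_eq_mul, smul_eq_mul,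
    ← intervalIntegral.integral_of_le hxy, ← intervalIntegral.integral_of_le hxy] at hJ
  have hI : 0 ≤ ∫ t in x..y, |w t| :=
    intervalIntegral.integral_nonneg hxy fun _ _ => abs_nonneg _
  rw [Real.mul_rpow (inv_nonneg.2 hpos.le) hI, Real.inv_rpow hpos.le] at hJ
  have hyp : 0 < (y - x) ^ p := Real.rpow_pos_of_pos hpos p
  calc |∫ t in x..y, w t| ^ p ≤ (∫ t in x..y, |w t|) ^ p :=
        Real.rpow_le_rpow (abs_nonneg _) (intervalIntegral.abs_integral_le_integral_abs hxy)
          (by linarith)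
    _ = (y - x) ^ p * (((y - x) ^ p)⁻¹ * (∫ t in x..y, |w t|) ^ p) := by
        rw [mul_inv_cancel_left₀ hyp.ne']
    _ ≤ (y - x) ^ p * ((y - x)⁻¹ * ∫ t in x..y, |w t| ^ p) := by gcongr
    _ = (y - x) ^ (p - 1) * ∫ t in x..y, |w t| ^ p := by
        rw [Real.rpow_sub_one hpos.ne']; ring

/-- A function with slope at least `m` on `[x, y]` has a large `L¹` norm there. -/
lemma slope_mul_sq_le_integral_abs {D : ℝ → ℝ} {m x y : ℝ} (hxy : x ≤ y)
    (hD : ContinuousOn D (Icc x y))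
    (hs : ∀ s ∈ Icc x y, ∀ t ∈ Icc x y, s ≤ t → m * (t - s) ≤ D t - D s) :
    m * (y - x) ^ 2 / 4 ≤ ∫ t in x..y, |D t| := by
  have hh : 0 ≤ (y - x) / 2 := by linarith
  have hi : ∀ u ∈ Icc x y, ∀ v ∈ Icc x y,
      IntervalIntegrable (fun t => |D t|) volume u v := fun u hu v hv =>
    ((hD.mono (Set.ordConnected_Icc.uIcc_subset hu hv)).abs).intervalIntegrable
  have hc : x + (y - x) / 2 ∈ Icc x y := ⟨by linarith, by linarith⟩
  have hx : x ∈ Icc x y := ⟨le_rfl, hxy⟩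
  have hy : y ∈ Icc x y := ⟨hxy, le_rfl⟩
  have h1 := hi x hx _ hc
  have h2 := hi _ hc y hy
  have h3 : IntervalIntegrable (fun t => |D (t + (y - x) / 2)|) volume x (x + (y - x) / 2) := by
    apply ContinuousOn.intervalIntegrable
    refine (hD.comp (by fun_prop) fun t ht => ?_).abs
    rw [uIcc_of_le (by linarith)] at ht
    exact ⟨by linarith [ht.1], by linarith [ht.2]⟩
  have hsum : ∫ t in x..y, |D t| =
      ∫ t in x..(x + (y - x) / 2), (|D t| + |D (t + (y - x) / 2)|) := by
    rw [intervalIntegral.integral_add h1 h3,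
      intervalIntegral.integral_comp_add_right (fun t => |D t|),
      ← intervalIntegral.integral_add_adjacent_intervals h1 h2]
    congr 2; ring
  have hle : ∫ t in x..(x + (y - x) / 2), m * ((y - x) / 2) ≤
      ∫ t in x..(x + (y - x) / 2), (|D t| + |D (t + (y - x) / 2)|) := by
    refine intervalIntegral.integral_mono_on (by linarith) (by simp) (h1.add h3) fun t ht => ?_
    have := hs t ⟨ht.1, by linarith [ht.2]⟩ (t + (y - x) / 2)
      ⟨by linarith [ht.1], by linarith [ht.2]⟩ (by linarith)
    have h4 := le_abs_self (D (t + (y - x) / 2))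
    have h5 := neg_abs_le (D t)
    rw [add_sub_cancel_left] at this
    linarith
  rw [hsum]
  refine le_trans (le_of_eq ?_) hle
  rw [intervalIntegral.integral_const, smul_eq_mul]; ring

/-- A continuous function descending from above `β` to below `α` does so on some subinterval in
whose interior it stays between `α` and `β`. -/
lemma exists_descent_interval {f : ℝ → ℝ} {α β x y : ℝ} (hxy : x ≤ y)
    (hf : ContinuousOn f (Icc x y)) (hx : β ≤ f x) (hy : f y ≤ α) :
    ∃ s t, x ≤ s ∧ s ≤ t ∧ t ≤ y ∧ β ≤ f s ∧ f t ≤ α ∧ ∀ r ∈ Ioo s t, α < f r ∧ f r < β := by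
  have hc1 : IsCompact {r ∈ Icc x y | β ≤ f r} :=
    isCompact_Icc.of_isClosed_subset
      (hf.preimage_isClosed_of_isClosed isClosed_Icc isClosed_Ici) fun r hr => hr.1
  obtain ⟨s, ⟨hs, hβ⟩, hmax⟩ := hc1.exists_isGreatest ⟨x, ⟨le_rfl, hxy⟩, hx⟩
  have hf' : ContinuousOn f (Icc s y) := hf.mono (Icc_subset_Icc_left hs.1)
  have hc2 : IsCompact {r ∈ Icc s y | f r ≤ α} :=
    isCompact_Icc.of_isClosed_subset
      (hf'.preimage_isClosed_of_isClosed isClosed_Icc isClosed_Iic) fun r hr => hr.1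
  obtain ⟨t, ⟨ht, hα⟩, hmin⟩ := hc2.exists_isLeast ⟨y, ⟨hs.2, le_rfl⟩, hy⟩
  refine ⟨s, t, hs.1, ht.1, ht.2, hβ, hα, fun r hr => ⟨?_, ?_⟩⟩
  · by_contra! h
    exact absurd (hmin ⟨⟨hr.1.le, hr.2.le.trans ht.2⟩, h⟩) (not_le.2 hr.2)
  · by_contra! h
    exact absurd (hmax ⟨⟨hs.1.trans hr.1.le, hr.2.le.trans ht.2⟩, h⟩) (not_le.2 hr.1)

/-- A continuous function taking values above `β` and below `α` crosses between them, in one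
direction or the other, on a subinterval in whose interior it stays between `α` and `β`. -/
lemma exists_crossing_interval {f : ℝ → ℝ} {α β c d x y : ℝ}
    (hf : ContinuousOn f (Icc c d)) (hxm : x ∈ Icc c d) (hym : y ∈ Icc c d)
    (hx : β ≤ f x) (hy : f y ≤ α) :
    ∃ s t, c ≤ s ∧ s ≤ t ∧ t ≤ d ∧ β - α ≤ |f t - f s| ∧
      ∀ r ∈ Ioo s t, α < f r ∧ f r < β := by
  rcases le_total x y with hxy | hxy
  · obtain ⟨s, t, h1, h2, h3, h4, h5, h6⟩ :=
      exists_descent_interval hxy (hf.mono (Icc_subset_Icc hxm.1 hym.2)) hx hy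
    refine ⟨s, t, hxm.1.trans h1, h2, h3.trans hym.2, ?_, h6⟩
    rw [abs_sub_comm]
    exact le_trans (by linarith) (le_abs_self _)
  · obtain ⟨s, t, h1, h2, h3, h4, h5, h6⟩ :=
      exists_descent_interval (f := fun r => -f r) (α := -β) (β := -α) hxy
        (hf.mono (Icc_subset_Icc hym.1 hxm.2)).neg (by linarith) (by linarith)
    refine ⟨s, t, hym.1.trans h1, h2, h3.trans hxm.2,
      le_trans (by linarith) (le_abs_self _), fun r hr => ?_⟩
    obtain ⟨h7, h8⟩ := h6 r hr
    exact ⟨by linarith, by linarith⟩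

/-- A point of `]a,b[` lies in a compact subinterval of any given length below `(b - a) / 2`. -/
lemma exists_Icc_subset_Ioo {a b x l : ℝ} (hx : x ∈ Ioo a b) (hl : 0 < l)
    (hlb : l < (b - a) / 2) : ∃ c, Icc c (c + l) ⊆ Ioo a b ∧ x ∈ Icc c (c + l) := by
  rcases le_total x ((a + b) / 2) with h | h
  · exact ⟨x, fun t ht => ⟨hx.1.trans_le ht.1, by linarith [ht.2]⟩, le_rfl, by linarith⟩
  · exact ⟨x - l, fun t ht => ⟨by linarith [ht.1], by linarith [ht.2, hx.2]⟩,
      by linarith, by linarith⟩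

lemma W2pRep.continuousOn {p a b : ℝ} {U v w : ℝ → ℝ} (h : W2pRep p a b U v w) :
    ContinuousOn v (Ioo a b) := by
  intro x hx
  obtain ⟨-, hv, -, -, hw, -⟩ := h
  have hcont : Continuous fun y => v x + ∫ t in x..y, (Ioo a b).indicator w t :=
    continuous_const.add
      (((integrable_indicator_iff measurableSet_Ioo).2 hw).continuous_primitive x)
  refine hcont.continuousWithinAt.congr (fun y hy => ?_) (by simp)
  have : ∫ t in x..y, (Ioo a b).indicator w t = ∫ t in x..y, w t :=
    intervalIntegral.integral_congr fun t ht =>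
      indicator_of_mem (Set.ordConnected_Ioo.uIcc_subset hx hy ht) _
  rw [this, ← hv x hx y hy]; ring

lemma W2pRep.neg {p a b : ℝ} {U v w : ℝ → ℝ} (h : W2pRep p a b U v w) :
    W2pRep p a b (-U) (-v) (-w) := by
  obtain ⟨h1, h2, h3, h4, h5, h6⟩ := h
  refine ⟨fun x hx => (h1 x hx).neg, fun x hx y hy => ?_, h3.neg, h4.neg, h5.neg, by simpa using h6⟩
  simp only [Pi.neg_apply, intervalIntegral.integral_neg, ← h2 x hx y hy]; ring

/-- A function of bounded energy that is `L¹`-close to a Lipschitz function has derivative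
bounded above. -/
lemma W2pRep.deriv_le {a b p K B δ l : ℝ} (hp : 1 < p) (hδ : 0 < δ)
    (hl : 0 < l) (hlb : l < (b - a) / 2) (hlB : l ^ (p - 1) * B < δ) {ψ : ℝ → ℝ}
    (hψ0 : ∀ t, 0 < ψ t) (hψδ : ∀ t ∈ Icc (K + 1) (K + 2), δ ≤ ψ t)
    {U v w g : ℝ → ℝ} (h : W2pRep p a b U v w)
    (hi : IntegrableOn (fun x => ψ (v x) * |w x| ^ p) (Ioo a b))
    (hB : ∫ x in Ioo a b, ψ (v x) * |w x| ^ p ≤ B)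
    (hg : ∀ s ∈ Icc a b, ∀ t ∈ Icc a b, |g t - g s| ≤ K * |t - s|)
    (hgc : ContinuousOn g (Icc a b))
    (hUg : ∫ x in Ioo a b, |U x - g x| < l ^ 2 / 4) {x : ℝ} (hx : x ∈ Ioo a b) :
    v x ≤ K + 2 := by
  have hvc := h.continuousOn
  obtain ⟨h1, h2, h3, -, h5, h6⟩ := h
  by_contra! hvx
  obtain ⟨c, hcs, hxc⟩ := exists_Icc_subset_Ioo hx hl hlb
  have hgi : IntegrableOn g (Ioo a b) := (hgc.integrableOn_Icc).mono_set Ioo_subset_Icc_self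
  obtain ⟨y, hy, hvy⟩ : ∃ y ∈ Icc c (c + l), v y ≤ K + 1 := by
    by_contra! hbig
    have hUc : ContinuousOn U (Icc c (c + l)) := fun t ht =>
      (h1 t (hcs ht)).continuousAt.continuousWithinAt
    have hgcs := hgc.mono (hcs.trans Ioo_subset_Icc_self)
    have key := slope_mul_sq_le_integral_abs (D := fun t => U t - g t) (m := 1)
      (x := c) (y := c + l) (by linarith) (hUc.sub hgcs) (fun s hs t ht hst => by
        have hU : (K + 1) * (t - s) ≤ U t - U s := by
          refine Convex.mul_sub_le_image_sub_of_le_deriv (convex_Icc c (c + l)) hUc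
            (fun r hr => (h1 r (hcs (interior_subset hr))).differentiableAt.differentiableWithinAt)
            (fun r hr => ?_) s hs t ht hst
          rw [(h1 r (hcs (interior_subset hr))).deriv]
          exact (hbig r (interior_subset hr)).le
        have hgg := hg s (Ioo_subset_Icc_self (hcs hs)) t (Ioo_subset_Icc_self (hcs ht))
        rw [abs_of_nonneg (sub_nonneg.2 hst)] at hgg
        have := (abs_le.1 hgg).2
        linarith)
    have hle : ∫ t in c..(c + l), |U t - g t| ≤ ∫ x in Ioo a b, |U x - g x| := by
      rw [intervalIntegral.integral_of_le (by linarith)]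
      exact setIntegral_mono_set (h3.sub hgi).abs (ae_of_all _ fun _ => abs_nonneg _)
        (Eventually.of_forall (Ioc_subset_Icc_self.trans hcs))
    rw [add_sub_cancel_left, one_mul] at key
    linarith
  obtain ⟨s, t, hs, hst, ht, hgap, hmid⟩ :=
    exists_crossing_interval (hvc.mono hcs) hxc hy hvx.le hvy
  have hsub : Ioc s t ⊆ Ioo a b := fun r hr => hcs ⟨hs.trans hr.1.le, hr.2.trans ht⟩
  have hsm : s ∈ Ioo a b := hcs ⟨hs, hst.trans ht⟩
  have htm : t ∈ Ioo a b := hcs ⟨hs.trans hst, ht⟩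
  have hJ := abs_intervalIntegral_rpow_le hp hst
    ((intervalIntegrable_iff_integrableOn_Ioc_of_le hst).2 (h5.mono_set hsub))
    ((intervalIntegrable_iff_integrableOn_Ioc_of_le hst).2 (h6.mono_set hsub))
  rw [← h2 s hsm t htm] at hJ
  have h10 : (1 : ℝ) ≤ |v t - v s| ^ p := Real.one_le_rpow (by linarith) (by linarith)
  have hE : δ * ∫ r in s..t, |w r| ^ p ≤ B := by
    refine le_trans ?_ hB
    rw [intervalIntegral.integral_of_le hst, ← integral_const_mul, integral_Ioc_eq_integral_Ioo]
    refine le_trans (setIntegral_mono_on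
      ((h6.mono_set (Ioo_subset_Ioc_self.trans hsub)).const_mul δ)
      (hi.mono_set (Ioo_subset_Ioc_self.trans hsub)) measurableSet_Ioo fun r hr => ?_)
      (setIntegral_mono_set hi (ae_of_all _ fun r => ?_)
        (Eventually.of_forall (Ioo_subset_Ioc_self.trans hsub)))
    · gcongr
      exact hψδ _ ⟨(hmid r hr).1.le, (hmid r hr).2.le⟩
    · exact mul_nonneg (hψ0 _).le (Real.rpow_nonneg (abs_nonneg _) _)
  have hE0 : 0 ≤ ∫ r in s..t, |w r| ^ p :=
    intervalIntegral.integral_nonneg hst fun r _ => Real.rpow_nonneg (abs_nonneg _) _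
  have hpow : (t - s) ^ (p - 1) ≤ l ^ (p - 1) :=
    Real.rpow_le_rpow (by linarith) (by linarith) (by linarith)
  have hl0 : 0 ≤ l ^ (p - 1) := Real.rpow_nonneg hl.le _
  have h11 : 1 ≤ l ^ (p - 1) * ∫ r in s..t, |w r| ^ p :=
    h10.trans (hJ.trans (mul_le_mul_of_nonneg_right hpow hE0))
  nlinarith [mul_le_mul_of_nonneg_left hE hl0, mul_le_mul_of_nonneg_left h11 hδ.le]

lemma W2pRep.integrableOn_energy {a b p : ℝ} {ψ : ℝ → ℝ} (hψ : PsiHypP ψ p)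
    {U v w : ℝ → ℝ} (h : W2pRep p a b U v w) :
    IntegrableOn (fun x => ψ (v x) * |w x| ^ p) (Ioo a b) := by
  obtain ⟨C, hC⟩ := hψ.bounded
  refine Integrable.bdd_mul (c := C) h.2.2.2.2.2 ?_ (ae_of_all _ fun x => ?_)
  · exact (hψ.measurable.comp_aemeasurable
      (h.continuousOn.aemeasurable measurableSet_Ioo)).aestronglyMeasurable
  · rw [Real.norm_eq_abs, abs_of_pos (hψ.pos _)]; exact hC _

lemma PsiHypP.comp_neg {ψ : ℝ → ℝ} {p : ℝ} (h : PsiHypP ψ p) : PsiHypP (fun t => ψ (-t)) p where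
  measurable := h.measurable.comp measurable_neg
  pos t := h.pos _
  bounded := h.bounded.imp fun _ hC t => hC _
  integrable := h.integrable.comp_neg
  inf_pos K hK := by
    obtain ⟨δ, hδ, hK'⟩ := h.inf_pos _ (hK.image continuous_neg)
    exact ⟨δ, hδ, fun t ht => hK' _ ⟨t, ht, rfl⟩⟩

/-- Bounded energy together with `L¹`-closeness to a `K`-Lipschitz function bounds the `L^p` norm
of the second derivative. -/
lemma exists_integral_rpow_le_of_close {a b p K B : ℝ} (hab : a < b) (hp : 1 < p)
    (hK : 0 ≤ K) {ψ : ℝ → ℝ} (hψ : PsiHypP ψ p) :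
    ∃ η > 0, ∃ A, ∀ U v w g : ℝ → ℝ, W2pRep p a b U v w →
      ∫ x in Ioo a b, ψ (v x) * |w x| ^ p ≤ B →
      (∀ s ∈ Icc a b, ∀ t ∈ Icc a b, |g t - g s| ≤ K * |t - s|) →
      ContinuousOn g (Icc a b) → ∫ x in Ioo a b, |U x - g x| < η →
      ∫ x in Ioo a b, |w x| ^ p ≤ A := by
  obtain ⟨δ, hδ, hψδ⟩ := hψ.inf_pos (Icc (-(K + 2)) (K + 2)) isCompact_Icc
  obtain ⟨l, hl, hlb, hlB⟩ : ∃ l > 0, l < (b - a) / 2 ∧ l ^ (p - 1) * B < δ := by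
    have ht : Tendsto (fun l : ℝ => l ^ (p - 1) * B) (𝓝[>] 0) (𝓝 0) := by
      have : ContinuousAt (fun l : ℝ => l ^ (p - 1) * B) 0 :=
        (Real.continuousAt_rpow_const 0 (p - 1) (Or.inr (by linarith))).mul continuousAt_const
      have h0 := this.tendsto
      rw [Real.zero_rpow (by linarith : p - 1 ≠ 0), zero_mul] at h0
      exact h0.mono_left nhdsWithin_le_nhds
    obtain ⟨l, h1, h2, h3⟩ := ((ht.eventually_lt_const hδ).and
      ((Ioo_mem_nhdsGT (show (0 : ℝ) < (b - a) / 2 by linarith)))).exists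
    exact ⟨l, h2, h3, h1⟩
  refine ⟨l ^ 2 / 4, by positivity, B / δ, fun U v w g h hEB hg hgc hUg => ?_⟩
  have hi := h.integrableOn_energy hψ
  have hbound : ∀ x ∈ Ioo a b, v x ∈ Icc (-(K + 2)) (K + 2) := fun x hx => by
    constructor
    · have := W2pRep.deriv_le (K := K) (g := fun t => -g t) hp hδ hl hlb hlB hψ.comp_neg.pos
        (fun t ht => hψδ _ ⟨by linarith [ht.2], by linarith [ht.1]⟩) h.neg (by simpa using hi)
        (by simpa using hEB)
        (fun s hs t ht => by
          have := hg s hs t ht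
          rwa [abs_sub_comm, ← neg_sub_neg] at this) hgc.neg
        (by simpa only [Pi.neg_apply, neg_sub_neg, abs_sub_comm (g _)] using hUg) hx
      simp only [Pi.neg_apply] at this
      linarith
    · exact W2pRep.deriv_le hp hδ hl hlb hlB hψ.pos
        (fun t ht => hψδ _ ⟨by linarith [ht.1], ht.2⟩) h hi hEB hg hgc hUg hx
  rw [le_div_iff₀' hδ, ← integral_const_mul]
  refine le_trans (setIntegral_mono_on (h.2.2.2.2.2.const_mul δ) hi measurableSet_Ioo
    fun x hx => ?_) hEB
  gcongr
  exact hψδ _ (hbound x hx)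

/-- `V` has increments controlled by a monotone function with values in `[0, A]`, as functions in
`W^{1,p}` with `∫ |V'|^p ≤ A` do. -/
def EnergyBound (p A : ℝ) (V : ℝ → ℝ) : Prop :=
  ∃ E : ℝ → ℝ, Monotone E ∧ (∀ x, E x ∈ Icc 0 A) ∧
    ∀ x y, x ≤ y → |V y - V x| ^ p ≤ (y - x) ^ (p - 1) * (E y - E x)

namespace EnergyBound

variable {p A : ℝ} {V : ℝ → ℝ}

lemma nonneg (h : EnergyBound p A V) : 0 ≤ A := by
  obtain ⟨E, -, hE, -⟩ := h
  exact (hE 0).1.trans (hE 0).2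

lemma abs_sub_rpow_le (h : EnergyBound p A V) (x y : ℝ) :
    |V y - V x| ^ p ≤ |y - x| ^ (p - 1) * A := by
  wlog hxy : x ≤ y generalizing x y
  · rw [abs_sub_comm, abs_sub_comm y]
    exact this y x (le_of_not_ge hxy)
  obtain ⟨E, -, hE, hV⟩ := h
  rw [abs_of_nonneg (sub_nonneg.2 hxy)]
  refine (hV x y hxy).trans ?_
  gcongr
  linarith [(hE y).2, (hE x).1]

/-- Functions of equally bounded energy are uniformly equicontinuous. -/
lemma exists_modulus (hp : 1 < p) (A : ℝ) {ε : ℝ} (hε : 0 < ε) :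
    ∃ l > 0, ∀ V, EnergyBound p A V → ∀ x y, |y - x| ≤ l → |V y - V x| ≤ ε := by
  have ht : Tendsto (fun l : ℝ => l ^ (p - 1) * A) (𝓝[>] 0) (𝓝 0) := by
    have : ContinuousAt (fun l : ℝ => l ^ (p - 1) * A) 0 :=
      (Real.continuousAt_rpow_const 0 (p - 1) (Or.inr (by linarith))).mul continuousAt_const
    have h0 := this.tendsto
    rw [Real.zero_rpow (by linarith : p - 1 ≠ 0), zero_mul] at h0
    exact h0.mono_left nhdsWithin_le_nhds
  obtain ⟨l, h1, h2⟩ := ((ht.eventually_lt_const (Real.rpow_pos_of_pos hε p)).and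
      self_mem_nhdsWithin).exists
  refine ⟨l, h2, fun V hV x y hxy => ?_⟩
  have hA := hV.nonneg
  rw [← Real.rpow_le_rpow_iff (abs_nonneg _) hε.le (by linarith : 0 < p)]
  refine (hV.abs_sub_rpow_le x y).trans (le_trans ?_ h1.le)
  gcongr

lemma continuous (hp : 1 < p) (h : EnergyBound p A V) : Continuous V := by
  rw [Metric.continuous_iff]
  intro x ε hε
  obtain ⟨l, hl, H⟩ := exists_modulus hp A (half_pos hε)
  refine ⟨l, hl, fun y hy => ?_⟩
  rw [Real.dist_eq] at hy ⊢
  linarith [H V h x y hy.le]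

lemma comp_clamp (hp : 1 < p) (h : EnergyBound p A V) {a b : ℝ} (hab : a ≤ b) :
    EnergyBound p A fun x => V (projIcc a b hab x) := by
  obtain ⟨E, hm, hE, hV⟩ := h
  have hmono : Monotone fun x => (projIcc a b hab x : ℝ) := fun x y hxy => monotone_projIcc hab hxy
  refine ⟨fun x => E (projIcc a b hab x), hm.comp hmono, fun x => hE _, fun x y hxy => ?_⟩
  refine (hV _ _ (hmono hxy)).trans ?_
  have h0 := hmono hxy
  have h1 : (projIcc a b hab y : ℝ) - projIcc a b hab x ≤ y - x := by
    have := (LipschitzWith.projIcc hab).dist_le_mul y x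
    rw [NNReal.coe_one, one_mul, Subtype.dist_eq, Real.dist_eq, Real.dist_eq,
      abs_of_nonneg (sub_nonneg.2 hxy)] at this
    exact (le_abs_self _).trans this
  refine mul_le_mul_of_nonneg_right ?_ (sub_nonneg.2 (hm h0))
  exact Real.rpow_le_rpow (sub_nonneg.2 h0) h1 (by linarith)

lemma lipschitz_comp (hp : 1 < p) (h : EnergyBound p A V) {f : ℝ → ℝ} {L : ℝ} (hL : 0 ≤ L)
    (hf : ∀ s t, |f t - f s| ≤ L * |t - s|) : EnergyBound p (L ^ p * A) fun x => f (V x) := by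
  obtain ⟨E, hm, hE, hV⟩ := h
  have hLp : 0 ≤ L ^ p := Real.rpow_nonneg hL p
  refine ⟨fun x => L ^ p * E x, fun x y hxy => mul_le_mul_of_nonneg_left (hm hxy) hLp,
    fun x => ⟨mul_nonneg hLp (hE x).1, mul_le_mul_of_nonneg_left (hE x).2 hLp⟩,
    fun x y hxy => ?_⟩
  calc |f (V y) - f (V x)| ^ p ≤ (L * |V y - V x|) ^ p :=
        Real.rpow_le_rpow (abs_nonneg _) (hf _ _) (by linarith)
    _ = L ^ p * |V y - V x| ^ p := Real.mul_rpow hL (abs_nonneg _)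
    _ ≤ L ^ p * ((y - x) ^ (p - 1) * (E y - E x)) := by gcongr; exact hV x y hxy
    _ = _ := by ring

/-- Bounded energy passes to pointwise limits. -/
lemma of_tendsto (hp : 1 < p) {W : ℕ → ℝ → ℝ} (hW : ∀ n, EnergyBound p A (W n))
    (hlim : ∀ x, Tendsto (fun n => W n x) atTop (𝓝 (V x))) : EnergyBound p A V := by
  choose E hm hE hV using hW
  let F : Ultrafilter ℕ := Filter.hyperfilter ℕ
  have hF : (F : Filter ℕ) ≤ atTop := Nat.hyperfilter_le_atTop
  have hex : ∀ x, ∃ e ∈ Icc 0 A, Tendsto (fun n => E n x) F (𝓝 e) := fun x =>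
    isCompact_Icc.ultrafilter_le_nhds (F.map fun n => E n x)
      (tendsto_principal.2 (Eventually.of_forall fun n => hE n x))
  choose e he hlimE using hex
  refine ⟨e, fun x y hxy => ?_, he, fun x y hxy => ?_⟩
  · exact le_of_tendsto_of_tendsto' (hlimE x) (hlimE y) fun n => hm n hxy
  · refine le_of_tendsto_of_tendsto' (b := (F : Filter ℕ)) ?_ ?_ fun n => hV n x y hxy
    · exact ((((hlim y).sub (hlim x)).mono_left hF).abs).rpow_const (Or.inr (by linarith))
    · exact ((hlimE y).sub (hlimE x)).const_mul _

/-- The increments of `V` are controlled by the measure of a finite Stieltjes measure. -/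
lemma exists_measure (hp : 1 < p) (h : EnergyBound p A V) :
    ∃ ν : Measure ℝ, IsFiniteMeasure ν ∧
      ∀ x y, x ≤ y → |V y - V x| ^ p ≤ (y - x) ^ (p - 1) * ν.real (Ioc x y) := by
  have hc := h.continuous hp
  obtain ⟨E, hm, hE, hV⟩ := h
  have hr : ∀ x, Tendsto E (𝓝[>] x) (𝓝 (hm.stieltjesFunction x)) := fun x => by
    rw [hm.stieltjesFunction_eq]
    exact hm.tendsto_rightLim x
  have hEs : ∀ x, hm.stieltjesFunction x ∈ Icc 0 A := fun x =>
    isClosed_Icc.mem_of_tendsto (hr x) (Eventually.of_forall fun y => hE y)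
  refine ⟨hm.stieltjesFunction.measure, ?_, fun x y hxy => ?_⟩
  · have hbb : BddBelow (range hm.stieltjesFunction) := ⟨0, by rintro _ ⟨x, rfl⟩; exact (hEs x).1⟩
    have hba : BddAbove (range hm.stieltjesFunction) := ⟨A, by rintro _ ⟨x, rfl⟩; exact (hEs x).2⟩
    exact hm.stieltjesFunction.isFiniteMeasure
      (tendsto_atBot_ciInf hm.stieltjesFunction.mono hbb)
      (tendsto_atTop_ciSup hm.stieltjesFunction.mono hba)
  · rw [Measure.real, StieltjesFunction.measure_Ioc,
      ENNReal.toReal_ofReal (sub_nonneg.2 (hm.stieltjesFunction.mono hxy))]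
    have hshift : ∀ z : ℝ, Tendsto (fun s : ℝ => z + s) (𝓝[>] 0) (𝓝[>] z) := fun z => by
      refine tendsto_nhdsWithin_iff.2 ⟨?_, ?_⟩
      · have : Tendsto (fun s : ℝ => z + s) (𝓝 0) (𝓝 (z + 0)) :=
          (continuous_const.add continuous_id).tendsto 0
        rw [add_zero] at this
        exact this.mono_left nhdsWithin_le_nhds
      · filter_upwards [self_mem_nhdsWithin] with s hs
        exact lt_add_of_pos_right z hs
    have hle : 𝓝[>] x ≤ 𝓝 x := nhdsWithin_le_nhds
    have hVs : ∀ z, Tendsto (fun s : ℝ => V (z + s)) (𝓝[>] 0) (𝓝 (V z)) := fun z =>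
      (hc.tendsto z).comp ((hshift z).mono_right nhdsWithin_le_nhds)
    refine le_of_tendsto_of_tendsto'
      ((((hVs y).sub (hVs x)).abs).rpow_const (Or.inr (by linarith)))
      ((((hr y).comp (hshift y)).sub ((hr x).comp (hshift x))).const_mul _) fun s => ?_
    have := hV (x + s) (y + s) (by linarith)
    rwa [add_sub_add_right_eq_sub] at this

lemma le_add_of_rpow_le {p c d t e : ℝ} (hp : 1 < p) (hc : 0 < c) (hd : 0 ≤ d)
    (he : 0 ≤ e) (h : t ^ p ≤ d ^ (p - 1) * e) : t ≤ c * d + (c ^ (p - 1))⁻¹ * e := by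
  have hcp : 0 < c ^ (p - 1) := Real.rpow_pos_of_pos hc _
  rcases le_or_gt t (c * d) with h1 | h1
  · have : 0 ≤ (c ^ (p - 1))⁻¹ * e := by positivity
    linarith
  · have htpos : 0 < t := lt_of_le_of_lt (by positivity) h1
    have h2 : (c * d) ^ (p - 1) * t ≤ d ^ (p - 1) * e := by
      refine le_trans ?_ h
      rw [← sub_add_cancel p 1, Real.rpow_add htpos, Real.rpow_one, add_sub_cancel_right]
      gcongr
    rw [Real.mul_rpow hc.le hd] at h2
    rcases hd.eq_or_lt with rfl | hd'
    · rw [Real.zero_rpow (by linarith : p - 1 ≠ 0), zero_mul] at h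
      exact absurd h (not_le.2 (Real.rpow_pos_of_pos htpos p))
    · have hdp : 0 < d ^ (p - 1) := Real.rpow_pos_of_pos hd' _
      have h3 : c ^ (p - 1) * t ≤ e := by
        refine le_of_mul_le_mul_left ?_ hdp
        linarith
      have h4 : t ≤ (c ^ (p - 1))⁻¹ * e := by
        rw [inv_mul_eq_div, le_div_iff₀' hcp]; exact h3
      have : 0 ≤ c * d := by positivity
      linarith

lemma absolutelyContinuousOnInterval (hp : 1 < p) (h : EnergyBound p A V) (a b : ℝ) :
    AbsolutelyContinuousOnInterval V a b := by
  obtain ⟨ν, hν, hV⟩ := h.exists_measure hp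
  rw [absolutelyContinuousOnInterval_iff]
  intro ε hε
  set M := ν.real univ
  have hM0 : 0 ≤ M := measureReal_nonneg
  obtain ⟨c, hcM, hc⟩ : ∃ c : ℝ, (c ^ (p - 1))⁻¹ * M < ε / 2 ∧ 0 < c := by
    have : Tendsto (fun c : ℝ => (c ^ (p - 1))⁻¹ * M) atTop (𝓝 (0 * M)) :=
      (tendsto_inv_atTop_zero.comp (tendsto_rpow_atTop (by linarith : 0 < p - 1))).mul_const M
    rw [zero_mul] at this
    exact ((this.eventually_lt_const (half_pos hε)).and (eventually_gt_atTop 0)).exists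
  have hcp : 0 < c ^ (p - 1) := Real.rpow_pos_of_pos hc _
  refine ⟨ε / (2 * c), by positivity, fun I hI hlen => ?_⟩
  have hinc : ∀ x y, dist (V x) (V y) ≤ c * dist x y + (c ^ (p - 1))⁻¹ * ν.real (uIoc x y) := by
    intro x y
    wlog hxy : x ≤ y generalizing x y
    · rw [dist_comm, dist_comm x, uIoc_comm]
      exact this y x (le_of_not_ge hxy)
    rw [uIoc_of_le hxy, dist_comm, dist_comm x, Real.dist_eq, Real.dist_eq,
      abs_of_nonneg (sub_nonneg.2 hxy)]
    exact le_add_of_rpow_le hp hc (sub_nonneg.2 hxy) measureReal_nonneg (hV x y hxy)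
  have hsum : ∑ i ∈ Finset.range I.1, ν.real (uIoc (I.2 i).1 (I.2 i).2) ≤ M := by
    rw [← measureReal_biUnion_finset hI.2 (fun i _ => measurableSet_uIoc)]
    exact measureReal_mono (subset_univ _)
  calc ∑ i ∈ Finset.range I.1, dist (V (I.2 i).1) (V (I.2 i).2)
      ≤ ∑ i ∈ Finset.range I.1, (c * dist (I.2 i).1 (I.2 i).2 +
          (c ^ (p - 1))⁻¹ * ν.real (uIoc (I.2 i).1 (I.2 i).2)) :=
        Finset.sum_le_sum fun i _ => hinc _ _
    _ = c * ∑ i ∈ Finset.range I.1, dist (I.2 i).1 (I.2 i).2 +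
          (c ^ (p - 1))⁻¹ * ∑ i ∈ Finset.range I.1, ν.real (uIoc (I.2 i).1 (I.2 i).2) := by
        rw [Finset.sum_add_distrib, Finset.mul_sum, Finset.mul_sum]
    _ ≤ c * ∑ i ∈ Finset.range I.1, dist (I.2 i).1 (I.2 i).2 + (c ^ (p - 1))⁻¹ * M := by
        gcongr
    _ < c * (ε / (2 * c)) + ε / 2 := by gcongr
    _ = ε := by field_simp; norm_num

lemma abs_deriv_rpow_le (hp : 1 < p) {E : ℝ → ℝ}
    (hV : ∀ x y, x ≤ y → |V y - V x| ^ p ≤ (y - x) ^ (p - 1) * (E y - E x)) {x : ℝ}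
    (h1 : DifferentiableAt ℝ V x) (h2 : DifferentiableAt ℝ E x) : |deriv V x| ^ p ≤ deriv E x := by
  have hs : ∀ f : ℝ → ℝ, DifferentiableAt ℝ f x → Tendsto (slope f x) (𝓝[>] x) (𝓝 (deriv f x)) :=
    fun f hf => (hasDerivAt_iff_tendsto_slope.1 hf.hasDerivAt).mono_left
      (nhdsWithin_mono x fun y hy => ne_of_gt hy)
  refine le_of_tendsto_of_tendsto (((hs V h1).abs).rpow_const (Or.inr (by linarith))) (hs E h2) ?_
  filter_upwards [self_mem_nhdsWithin] with y hy
  have hpos : 0 < y - x := sub_pos.2 hy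
  have hyp : 0 < (y - x) ^ p := Real.rpow_pos_of_pos hpos p
  rw [slope_def_field, slope_def_field, abs_div, abs_of_pos hpos,
    Real.div_rpow (abs_nonneg _) hpos.le, div_le_iff₀ hyp]
  refine (hV x y (le_of_lt hy)).trans (le_of_eq ?_)
  rw [Real.rpow_sub_one hpos.ne']; ring

/-- Functions of bounded energy are in `W^{1,p}`. -/
lemma memW1pOn (hp : 1 < p) (h : EnergyBound p A V) {a b : ℝ} (hab : a < b) :
    MemW1pOn p a b V := by
  have hac := h.absolutelyContinuousOnInterval hp
  obtain ⟨E, hm, hE, hV⟩ := h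
  have hsub : Ioo a b ⊆ Ioc a b := Ioo_subset_Ioc_self
  refine ⟨V, deriv V, ae_of_all _ fun _ => rfl,
    ((hac a b).intervalIntegrable_deriv.1).mono_set hsub, ?_,
    fun x _ y _ => (hac x y).integral_deriv_eq_sub.symm⟩
  have hEi : IntegrableOn (deriv E) (Ioo a b) :=
    ((hm.monotoneOn (uIcc a b)).intervalIntegrable_deriv.1).mono_set hsub
  refine Integrable.mono' hEi ?_ ?_
  · exact ((measurable_deriv V).norm.pow_const p).aestronglyMeasurable
  · refine (ae_restrict_iff' measurableSet_Ioo).2 ?_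
    filter_upwards [(hac a b).ae_differentiableAt, hm.ae_differentiableAt] with x h1 h2 hx
    rw [Real.norm_eq_abs, abs_of_nonneg (Real.rpow_nonneg (abs_nonneg _) _)]
    refine abs_deriv_rpow_le hp hV (h1 ?_) h2
    rw [uIcc_of_le hab.le]
    exact Ioo_subset_Icc_self hx

end EnergyBound

/-- `V` is the derivative of `U` on `ℝ`, with energy bounded by `A`. -/
def C1Bound (p A : ℝ) (U V : ℝ → ℝ) : Prop :=
  (∀ x, HasDerivAt U (V x) x) ∧ EnergyBound p A V

/-- A function in `W^{2,p}(]a,b[)` extends to a `C¹` function on `ℝ` of the same energy. -/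
lemma W2pRep.exists_c1Bound {p a b A : ℝ} (hab : a < b) (hp : 1 < p) {U v w : ℝ → ℝ}
    (h : W2pRep p a b U v w) (hA : ∫ x in Ioo a b, |w x| ^ p ≤ A) :
    ∃ U' V', C1Bound p A U' V' ∧ EqOn U' U (Ioo a b) := by
  obtain ⟨h1, h2, -, -, h5, h6⟩ := h
  have hp0 : p ≠ 0 := by linarith
  set m := (a + b) / 2 with hm
  have hmm : m ∈ Ioo a b := ⟨by linarith, by linarith⟩
  set W := (Ioo a b).indicator w with hW
  have hWi : Integrable W := (integrable_indicator_iff measurableSet_Ioo).2 h5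
  have hWp : (fun x => |W x| ^ p) = (Ioo a b).indicator fun x => |w x| ^ p := by
    ext x
    by_cases hx : x ∈ Ioo a b <;> simp [hW, hx, Real.zero_rpow hp0]
  have hWpi : Integrable fun x => |W x| ^ p := by
    rw [hWp]; exact (integrable_indicator_iff measurableSet_Ioo).2 h6
  have hWA : ∫ x, |W x| ^ p ≤ A := by
    rw [hWp, integral_indicator measurableSet_Ioo]; exact hA
  have hnn : ∀ x, 0 ≤ |W x| ^ p := fun x => Real.rpow_nonneg (abs_nonneg _) _
  set V' : ℝ → ℝ := fun x => v m + ∫ t in m..x, W t with hV'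
  have hV'c : Continuous V' := continuous_const.add (hWi.continuous_primitive m)
  have hdiff : ∀ x y, V' y - V' x = ∫ t in x..y, W t := fun x y => by
    simp only [hV', add_sub_add_left_eq_sub]
    exact intervalIntegral.integral_interval_sub_left hWi.intervalIntegrable
      hWi.intervalIntegrable
  have hEq : EqOn V' v (Ioo a b) := fun x hx => by
    have : ∫ t in m..x, W t = ∫ t in m..x, w t :=
      intervalIntegral.integral_congr fun t ht =>
        indicator_of_mem (Set.ordConnected_Ioo.uIcc_subset hmm hx ht) _
    simp only [hV', this, ← h2 m hmm x hx]; ring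
  set U' : ℝ → ℝ := fun x => U m + ∫ t in m..x, V' t with hU'
  have hdU' : ∀ x, HasDerivAt U' (V' x) x := fun x =>
    (intervalIntegral.integral_hasDerivAt_right (hV'c.intervalIntegrable _ _)
      (hV'c.stronglyMeasurableAtFilter _ _) hV'c.continuousAt).const_add (U m)
  refine ⟨U', V', ⟨hdU', fun x => ∫ t in Iic x, |W t| ^ p, fun x y hxy => ?_, fun x => ⟨?_, ?_⟩,
    fun x y hxy => ?_⟩, fun x hx => ?_⟩
  · exact setIntegral_mono_set hWpi.integrableOn (ae_of_all _ hnn)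
      (Eventually.of_forall (Iic_subset_Iic.2 hxy))
  · exact integral_nonneg hnn
  · exact (setIntegral_le_integral hWpi (ae_of_all _ hnn)).trans hWA
  · rw [hdiff, intervalIntegral.integral_Iic_sub_Iic hWpi.integrableOn hWpi.integrableOn]
    exact abs_intervalIntegral_rpow_le hp hxy hWi.intervalIntegrable hWpi.intervalIntegrable
  · have hsub := Set.ordConnected_Ioo.uIcc_subset hmm hx
    have h7 : ∫ t in m..x, V' t = U x - U m := by
      refine intervalIntegral.integral_eq_sub_of_hasDerivAt (fun t ht => ?_)
        (hV'c.intervalIntegrable _ _)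
      rw [hEq (hsub ht)]
      exact h1 t (hsub ht)
    simp only [hU', h7]; ring

/-- If `|E| > ε` at a point and `E = D'` varies little, then `D` is large in `L¹`. -/
lemma sq_le_integral_abs_of_lt_deriv {a b l ε : ℝ} (hl : 0 < l) (hlb : l ≤ (b - a) / 2)
    {D E : ℝ → ℝ} (hD : ∀ x, HasDerivAt D (E x) x) (hE : ∀ x y, |y - x| ≤ l → |E y - E x| ≤ ε / 2)
    {x : ℝ} (hx : x ∈ Icc a b) (hxE : ε < E x) :
    ε / 2 * l ^ 2 / 4 ≤ ∫ t in Ioo a b, |D t| := by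
  have hDc : Continuous D := continuous_iff_continuousAt.2 fun t => (hD t).continuousAt
  obtain ⟨c, hcs, hxc⟩ : ∃ c, Icc c (c + l) ⊆ Icc a b ∧ x ∈ Icc c (c + l) := by
    rcases le_total x ((a + b) / 2) with h | h
    · exact ⟨x, Icc_subset_Icc hx.1 (by linarith), le_rfl, by linarith⟩
    · exact ⟨x - l, Icc_subset_Icc (by linarith) (by linarith [hx.2]), by linarith, by linarith⟩
  have key := slope_mul_sq_le_integral_abs (D := D) (m := ε / 2) (x := c) (y := c + l)
    (by linarith) hDc.continuousOn fun s hs t ht hst =>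
      Convex.mul_sub_le_image_sub_of_le_deriv (convex_Icc c (c + l)) hDc.continuousOn
        (fun r _ => (hD r).differentiableAt.differentiableWithinAt)
        (fun r hr => by
          have hr' := interior_subset hr
          have := hE x r (abs_le.2 ⟨by linarith [hr'.1, hxc.2], by linarith [hr'.2, hxc.1]⟩)
          rw [(hD r).deriv]
          linarith [(abs_le.1 this).1]) s hs t ht hst
  rw [add_sub_cancel_left] at key
  refine key.trans ?_
  rw [intervalIntegral.integral_of_le (by linarith), ← integral_Icc_eq_integral_Ioo]
  exact setIntegral_mono_set hDc.abs.integrableOn_Icc (ae_of_all _ fun _ => abs_nonneg _)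
    (Eventually.of_forall (Ioc_subset_Icc_self.trans hcs))

/-- On functions of bounded energy, `L¹`-closeness implies `C¹`-closeness. -/
lemma C1Bound.exists_close {p a b : ℝ} (hab : a < b) (hp : 1 < p) (A : ℝ) {ε : ℝ} (hε : 0 < ε) :
    ∃ η > 0, ∀ U₁ V₁ U₂ V₂, C1Bound p A U₁ V₁ → C1Bound p A U₂ V₂ →
      ∫ x in Ioo a b, |U₁ x - U₂ x| < η →
      ∀ x ∈ Icc a b, |U₁ x - U₂ x| ≤ ε ∧ |V₁ x - V₂ x| ≤ ε := by
  set ε' := min ε (ε / (2 * (b - a)))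
  have hba : 0 < b - a := sub_pos.2 hab
  have hε'0 : 0 < ε' := lt_min hε (by positivity)
  obtain ⟨l₀, hl₀, hmod⟩ := EnergyBound.exists_modulus hp A (show 0 < ε' / 4 by positivity)
  set l := min l₀ ((b - a) / 2)
  have hl0 : 0 < l := lt_min hl₀ (by positivity)
  refine ⟨min (ε' / 2 * l ^ 2 / 4) (ε / 2 * (b - a)), lt_min (by positivity) (by positivity),
    fun U₁ V₁ U₂ V₂ h₁ h₂ hη => ?_⟩
  have hDd : ∀ x, HasDerivAt (fun x => U₁ x - U₂ x) (V₁ x - V₂ x) x := fun x =>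
    (h₁.1 x).sub (h₂.1 x)
  have hDc : Continuous fun x => U₁ x - U₂ x :=
    continuous_iff_continuousAt.2 fun t => (hDd t).continuousAt
  have hE : ∀ x y, |y - x| ≤ l → |(V₁ y - V₂ y) - (V₁ x - V₂ x)| ≤ ε' / 2 := fun x y hxy => by
    have h3 := hmod V₁ h₁.2 x y (hxy.trans (min_le_left _ _))
    have h4 := hmod V₂ h₂.2 x y (hxy.trans (min_le_left _ _))
    rw [abs_le] at *
    constructor <;> linarith
  have hV : ∀ x ∈ Icc a b, |V₁ x - V₂ x| ≤ ε' := fun x hx => by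
    by_contra! hlt
    refine absurd (hη.trans_le (min_le_left _ _)) (not_lt.2 ?_)
    rcases lt_abs.1 hlt with h | h
    · exact sq_le_integral_abs_of_lt_deriv hl0 (min_le_right _ _) hDd hE hx h
    · have := sq_le_integral_abs_of_lt_deriv hl0 (min_le_right _ _) (fun x => (hDd x).neg)
        (fun x y hxy => by
          rw [neg_sub_neg, abs_sub_comm]; exact hE x y hxy) hx h
      simpa only [Pi.neg_apply, abs_neg] using this
  refine fun x hx => ⟨?_, (hV x hx).trans (min_le_left _ _)⟩
  by_contra! hlt
  have hosc : ∀ y ∈ Icc a b, ε / 2 ≤ |U₁ y - U₂ y| := fun y hy => by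
    have h3 := (convex_Icc a b).norm_image_sub_le_of_norm_hasDerivWithin_le
      (f := fun x => U₁ x - U₂ x) (fun t _ => (hDd t).hasDerivWithinAt)
      (C := ε / (2 * (b - a))) (fun t ht => (hV t ht).trans (min_le_right _ _)) hy hx
    rw [Real.norm_eq_abs, Real.norm_eq_abs] at h3
    have h4 : |x - y| ≤ b - a := abs_le.2 ⟨by linarith [hx.1, hy.2], by linarith [hx.2, hy.1]⟩
    have h5 : ε / (2 * (b - a)) * |x - y| ≤ ε / 2 := by
      calc ε / (2 * (b - a)) * |x - y| ≤ ε / (2 * (b - a)) * (b - a) := by gcongr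
        _ = ε / 2 := by field_simp
    have h6 := abs_sub_abs_le_abs_sub (U₁ x - U₂ x) (U₁ y - U₂ y)
    linarith
  have h7 : ∫ t in Ioo a b, ε / 2 ≤ ∫ t in Ioo a b, |U₁ t - U₂ t| :=
    setIntegral_mono_on (by simp) (hDc.abs.integrableOn_Icc.mono_set Ioo_subset_Icc_self)
      measurableSet_Ioo fun t ht => hosc t (Ioo_subset_Icc_self ht)
  rw [setIntegral_const, smul_eq_mul, Real.volume_real_Ioo_of_le hab.le] at h7
  have := hη.trans_le (min_le_right _ _)
  linarith

/-- A sequence of functions of bounded energy converging in `L¹` converges in `C¹([a,b])`. -/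
lemma C1Bound.exists_limit {p a b A : ℝ} (hab : a < b) (hp : 1 < p) {U V : ℕ → ℝ → ℝ}
    (h : ∀ n, C1Bound p A (U n) (V n)) {u : ℝ → ℝ} (hu : IntegrableOn u (Ioo a b))
    (hlim : Tendsto (fun n => ∫ x in Ioo a b, |U n x - u x|) atTop (𝓝 0)) :
    ∃ U' V', C1Bound p A U' V' ∧ (∀ᵐ x ∂volume.restrict (Ioo a b), U' x = u x) ∧
      ∀ ε > 0, ∃ N, ∀ n ≥ N, ∀ x ∈ Icc a b, |U n x - U' x| ≤ ε ∧ |V n x - V' x| ≤ ε := by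
  have hUc : ∀ n, Continuous (U n) := fun n =>
    continuous_iff_continuousAt.2 fun t => ((h n).1 t).continuousAt
  have hVc : ∀ n, Continuous (V n) := fun n => (h n).2.continuous hp
  have hUi : ∀ n, IntegrableOn (U n) (Ioo a b) := fun n =>
    (hUc n).integrableOn_Icc.mono_set Ioo_subset_Icc_self
  have hi : ∀ n, IntegrableOn (fun x => |U n x - u x|) (Ioo a b) := fun n =>
    ((hUi n).sub hu).abs
  have hCauchy : ∀ ε > 0, ∃ N, ∀ n ≥ N, ∀ k ≥ N, ∀ x ∈ Icc a b,
      |U n x - U k x| ≤ ε ∧ |V n x - V k x| ≤ ε := fun ε hε => by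
    obtain ⟨η, hη, H⟩ := C1Bound.exists_close hab hp A hε
    obtain ⟨N, hN⟩ := eventually_atTop.1 (hlim.eventually_lt_const (half_pos hη))
    refine ⟨N, fun n hn k hk => H _ _ _ _ (h n) (h k) ?_⟩
    have h1 : ∫ x in Ioo a b, |U n x - U k x| ≤
        ∫ x in Ioo a b, (|U n x - u x| + |U k x - u x|) := by
      refine integral_mono ((hUi n).sub (hUi k)).abs
        ((hi n).add (hi k)) fun x => ?_
      have := abs_sub_le (U n x) (u x) (U k x)
      rwa [abs_sub_comm (u x)] at this
    rw [integral_add (hi n) (hi k)] at h1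
    linarith [hN n hn, hN k hk]
  have hexU : ∀ x ∈ Icc a b, ∃ y, Tendsto (fun n => U n x) atTop (𝓝 y) := fun x hx =>
    cauchySeq_tendsto_of_complete (Metric.cauchySeq_iff.2 fun ε hε => by
      obtain ⟨N, hN⟩ := hCauchy (ε / 2) (half_pos hε)
      exact ⟨N, fun n hn k hk => lt_of_le_of_lt (hN n hn k hk x hx).1 (half_lt_self hε)⟩)
  have hexV : ∀ x : ℝ, ∃ y, Tendsto (fun n => V n (projIcc a b hab.le x)) atTop (𝓝 y) := fun x =>
    cauchySeq_tendsto_of_complete (Metric.cauchySeq_iff.2 fun ε hε => by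
      obtain ⟨N, hN⟩ := hCauchy (ε / 2) (half_pos hε)
      exact ⟨N, fun n hn k hk =>
        lt_of_le_of_lt (hN n hn k hk _ (projIcc a b hab.le x).2).2 (half_lt_self hε)⟩)
  choose V' hV' using hexV
  obtain ⟨c, hc⟩ := hexU a ⟨le_rfl, hab.le⟩
  have hV'E : EnergyBound p A V' :=
    EnergyBound.of_tendsto hp (fun n => (h n).2.comp_clamp hp hab.le) hV'
  have hV'c := hV'E.continuous hp
  have hV'lim : ∀ x ∈ Icc a b, Tendsto (fun n => V n x) atTop (𝓝 (V' x)) := fun x hx => by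
    simpa only [projIcc_of_mem hab.le hx] using hV' x
  have hVunif : ∀ ε > 0, ∃ N, ∀ n ≥ N, ∀ x ∈ Icc a b, |V n x - V' x| ≤ ε := fun ε hε => by
    obtain ⟨N, hN⟩ := hCauchy ε hε
    refine ⟨N, fun n hn x hx => le_of_tendsto ((hV'lim x hx).const_sub (V n x)).abs ?_⟩
    filter_upwards [eventually_ge_atTop N] with k hk using (hN n hn k hk x hx).2
  set U' : ℝ → ℝ := fun x => c + ∫ t in a..x, V' t
  have hU'lim : ∀ x ∈ Icc a b, Tendsto (fun n => U n x) atTop (𝓝 (U' x)) := fun x hx => by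
    have hFTC : ∀ n, U n x = U n a + ∫ t in a..x, V n t := fun n => by
      rw [intervalIntegral.integral_eq_sub_of_hasDerivAt (fun t _ => (h n).1 t)
        ((hVc n).intervalIntegrable _ _)]
      ring
    simp only [hFTC]
    refine hc.add (Metric.tendsto_atTop.2 fun ε hε => ?_)
    have hba : 0 < b - a := sub_pos.2 hab
    obtain ⟨N, hN⟩ := hVunif (ε / (2 * (b - a))) (by positivity)
    refine ⟨N, fun n hn => ?_⟩
    rw [Real.dist_eq, ← intervalIntegral.integral_sub ((hVc n).intervalIntegrable _ _)
      (hV'c.intervalIntegrable _ _)]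
    have h2 := intervalIntegral.norm_integral_le_of_norm_le_const (a := a) (b := x)
      (f := fun t => V n t - V' t) (C := ε / (2 * (b - a))) fun t ht => by
        rw [uIoc_of_le hx.1] at ht
        exact hN n hn t ⟨ht.1.le, ht.2.trans hx.2⟩
    rw [Real.norm_eq_abs, abs_of_nonneg (sub_nonneg.2 hx.1)] at h2
    calc _ ≤ ε / (2 * (b - a)) * (x - a) := h2
      _ ≤ ε / (2 * (b - a)) * (b - a) := by gcongr; exact hx.2
      _ = ε / 2 := by field_simp
      _ < ε := half_lt_self hε
  have hunif : ∀ ε > 0, ∃ N, ∀ n ≥ N, ∀ x ∈ Icc a b,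
      |U n x - U' x| ≤ ε ∧ |V n x - V' x| ≤ ε := fun ε hε => by
    obtain ⟨N, hN⟩ := hCauchy ε hε
    refine ⟨N, fun n hn x hx => ⟨le_of_tendsto ((hU'lim x hx).const_sub (U n x)).abs ?_,
      le_of_tendsto ((hV'lim x hx).const_sub (V n x)).abs ?_⟩⟩
    · filter_upwards [eventually_ge_atTop N] with k hk using (hN n hn k hk x hx).1
    · filter_upwards [eventually_ge_atTop N] with k hk using (hN n hn k hk x hx).2
  have hdU' : ∀ x, HasDerivAt U' (V' x) x := fun x =>
    (intervalIntegral.integral_hasDerivAt_right (hV'c.intervalIntegrable _ _)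
      (hV'c.stronglyMeasurableAtFilter _ _) hV'c.continuousAt).const_add c
  have hU'c : Continuous U' := continuous_iff_continuousAt.2 fun t => (hdU' t).continuousAt
  have hU'i : IntegrableOn U' (Ioo a b) := hU'c.integrableOn_Icc.mono_set Ioo_subset_Icc_self
  refine ⟨U', V', ⟨hdU', hV'E⟩, ?_, hunif⟩
  have hzero : ∫ x in Ioo a b, |U' x - u x| ≤ 0 := by
    refine le_of_forall_pos_le_add fun ε hε => ?_
    have hba : 0 < b - a := sub_pos.2 hab
    obtain ⟨N, hN⟩ := hunif (ε / (2 * (b - a))) (by positivity)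
    obtain ⟨n, hn, hnN⟩ := ((hlim.eventually_lt_const (half_pos hε)).and
      (eventually_ge_atTop N)).exists
    have h1 : ∫ x in Ioo a b, |U' x - u x| ≤
        ∫ x in Ioo a b, (ε / (2 * (b - a)) + |U n x - u x|) := by
      refine setIntegral_mono_on (hU'i.sub hu).abs
        ((integrable_const _).add (hi n)) measurableSet_Ioo fun x hx => ?_
      have h3 := (hN n hnN x (Ioo_subset_Icc_self hx)).1
      have := abs_sub_le (U' x) (U n x) (u x)
      rw [abs_sub_comm (U' x) (U n x)] at this
      linarith
    rw [integral_add (integrable_const _) (hi n), setIntegral_const, smul_eq_mul,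
      Real.volume_real_Ioo_of_le hab.le] at h1
    have h4 : (b - a) * (ε / (2 * (b - a))) = ε / 2 := by field_simp
    linarith
  have h0 := (integral_eq_zero_iff_of_nonneg (fun x => abs_nonneg _) (hU'i.sub hu).abs).1
    (le_antisymm hzero (integral_nonneg fun x => abs_nonneg _))
  filter_upwards [h0] with x hx
  simpa [sub_eq_zero] using hx

/-- The measure with density the positive part of `W`. -/
def posDensity (W : ℝ → ℝ) : Measure ℝ := volume.withDensity fun x => ENNReal.ofReal (W x)

lemma isFiniteMeasure_posDensity {W : ℝ → ℝ} (hW : Integrable W) :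
    IsFiniteMeasure (posDensity W) :=
  isFiniteMeasure_withDensity_ofReal hW.2

lemma posDensity_apply_eq_zero {W : ℝ → ℝ} {s : Set ℝ} (hs : MeasurableSet s)
    (h : ∀ x ∈ s, W x ≤ 0) : posDensity W s = 0 := by
  rw [posDensity, withDensity_apply _ hs, setLIntegral_congr_fun hs (g := fun _ => 0)
    fun x hx => ENNReal.ofReal_of_nonpos (h x hx), lintegral_zero]

lemma integral_posDensity {W : ℝ → ℝ} (hW : Measurable W) (φ : ℝ → ℝ) :
    ∫ x, φ x ∂posDensity W = ∫ x, max (W x) 0 * φ x := by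
  rw [posDensity, integral_withDensity_eq_integral_toReal_smul hW.ennreal_ofReal
    (ae_of_all _ fun _ => ENNReal.ofReal_lt_top)]
  simp [ENNReal.toReal_ofReal']

lemma rnDeriv_posDensity {W : ℝ → ℝ} (hW : Measurable W) :
    (posDensity W).rnDeriv volume =ᵐ[volume] fun x => ENNReal.ofReal (W x) :=
  Measure.rnDeriv_withDensity volume hW.ennreal_ofReal

lemma singularPart_posDensity (W : ℝ → ℝ) : (posDensity W).singularPart volume = 0 :=
  Measure.singularPart_withDensity _ _

lemma uaD_posDensity {W : ℝ → ℝ} (hW : Measurable W) :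
    uaD (posDensity W) (posDensity (-W)) =ᵐ[volume] W := by
  filter_upwards [rnDeriv_posDensity hW, rnDeriv_posDensity hW.neg] with x h1 h2
  rw [uaD, h1, h2, ENNReal.toReal_ofReal', ENNReal.toReal_ofReal', Pi.neg_apply,
    max_zero_sub_max_neg_zero_eq_self]

/-- A `C¹` function has an absolutely continuous derivative measure. -/
lemma isDerivMeasures_posDensity {a b : ℝ} (hab : a < b) {U V u : ℝ → ℝ}
    (hU : ∀ x, HasDerivAt U (V x) x) (hV : Continuous V)
    (hu : U =ᵐ[volume.restrict (Ioo a b)] u) :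
    IsDerivMeasures a b u (posDensity ((Ioo a b).indicator V))
      (posDensity (-(Ioo a b).indicator V)) := by
  set W := (Ioo a b).indicator V with hW
  have hWm : Measurable W := hV.measurable.indicator measurableSet_Ioo
  have hWi : Integrable W := (integrable_indicator_iff measurableSet_Ioo).2
    (hV.integrableOn_Icc.mono_set Ioo_subset_Icc_self)
  have hUc : Continuous U := continuous_iff_continuousAt.2 fun t => (hU t).continuousAt
  have hW0 : ∀ x ∈ (Ioo a b)ᶜ, W x = 0 := fun x hx => indicator_of_notMem hx _
  refine ⟨(hUc.integrableOn_Icc.mono_set Ioo_subset_Icc_self).congr hu,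
    isFiniteMeasure_posDensity hWi, isFiniteMeasure_posDensity hWi.neg,
    ⟨{x | W x ≤ 0}, measurableSet_le hWm measurable_const,
      posDensity_apply_eq_zero (measurableSet_le hWm measurable_const) fun _ => id,
      posDensity_apply_eq_zero (measurableSet_le hWm measurable_const).compl
        fun x hx => neg_nonpos.2 (le_of_not_ge hx)⟩,
    posDensity_apply_eq_zero measurableSet_Ioo.compl fun x hx => (hW0 x hx).le,
    posDensity_apply_eq_zero measurableSet_Ioo.compl fun x hx => by simp [hW0 x hx],
    fun φ hφ hsupp => ?_⟩
  have hφs : HasCompactSupport φ := HasCompactSupport.of_support_subset_isCompact isCompact_Icc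
    ((subset_tsupport φ).trans (hsupp.trans Ioo_subset_Icc_self))
  obtain ⟨C, hC⟩ := hφs.exists_bound_of_continuous hφ.continuous
  have hmul : ∀ f : ℝ → ℝ, Integrable f → Integrable fun x => max (f x) 0 * φ x := fun f hf =>
    hf.pos_part.mul_bdd (c := C) hφ.continuous.aestronglyMeasurable (ae_of_all _ hC)
  rw [integral_posDensity hWm, integral_posDensity hWm.neg,
    ← integral_sub (hmul _ hWi.neg) (hmul _ hWi)]
  have h1 : ∀ x, max ((-W) x) 0 * φ x - max (W x) 0 * φ x =
      (Ioo a b).indicator (fun x => -(V x * φ x)) x := fun x => by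
    rw [Pi.neg_apply, ← sub_mul, ← neg_sub, max_zero_sub_max_neg_zero_eq_self]
    by_cases hx : x ∈ Ioo a b <;> simp [hW, hx]
  have h2 : ∫ x in Ioo a b, u x * deriv φ x = ∫ x in Ioo a b, U x * deriv φ x := by
    refine integral_congr_ae ?_
    filter_upwards [hu] with x hx
    rw [hx]
  have hφ0 : ∀ x ∉ Ioo a b, φ x = 0 := fun x hx => image_eq_zero_of_notMem_tsupport fun h =>
    hx (hsupp h)
  simp only [h1]
  rw [integral_indicator measurableSet_Ioo, h2, ← integral_Ioc_eq_integral_Ioo,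
    ← integral_Ioc_eq_integral_Ioo, ← intervalIntegral.integral_of_le hab.le,
    ← intervalIntegral.integral_of_le hab.le, intervalIntegral.integral_neg,
    intervalIntegral.integral_mul_deriv_eq_deriv_mul (fun x _ => hU x)
      (fun x _ => (hφ.differentiable one_ne_zero x).hasDerivAt) (hV.intervalIntegrable _ _)
      ((hφ.continuous_deriv le_rfl).intervalIntegrable _ _), hφ0 a (by simp), hφ0 b (by simp)]
  ring

lemma PsiHypP.exists_abs_psip_sub_le {ψ : ℝ → ℝ} {p : ℝ} (hp : 1 < p) (hψ : PsiHypP ψ p) :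
    ∃ L, 0 ≤ L ∧ ∀ s t, |Psip ψ p t - Psip ψ p s| ≤ L * |t - s| := by
  obtain ⟨C, hC⟩ := hψ.bounded
  have hC0 : 0 ≤ C := (hψ.pos 0).le.trans (hC 0)
  refine ⟨C ^ (1 / p), by positivity, fun s t => ?_⟩
  rw [Psip, Psip, intervalIntegral.integral_Iic_sub_Iic hψ.integrable.integrableOn
    hψ.integrable.integrableOn]
  refine intervalIntegral.norm_integral_le_of_norm_le_const (E := ℝ) fun x _ => ?_
  rw [Real.norm_of_nonneg (Real.rpow_nonneg (hψ.pos x).le _)]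
  exact Real.rpow_le_rpow (hψ.pos x).le (hC x) (by positivity)

/-- Functions of bounded energy belong to `X^p_ψ(]a,b[)`. -/
lemma C1Bound.memXp {p a b A : ℝ} (hab : a < b) (hp : 1 < p) {ψ : ℝ → ℝ} (hψ : PsiHypP ψ p)
    {U V u : ℝ → ℝ} (h : C1Bound p A U V) (hu : U =ᵐ[volume.restrict (Ioo a b)] u) :
    ∃ μp μn : Measure ℝ, MemXp ψ p a b u μp μn := by
  have hV : Continuous V := h.2.continuous hp
  obtain ⟨L, hL0, hL⟩ := hψ.exists_abs_psip_sub_le hp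
  obtain ⟨f, w, hfw, hw⟩ := (h.2.lipschitz_comp hp hL0 hL).memW1pOn hp hab
  refine ⟨_, _, isDerivMeasures_posDensity hab h.1 hV hu, ⟨f, w, ?_, hw⟩, ?_, ?_⟩
  · filter_upwards [hfw, ae_restrict_of_ae (uaD_posDensity (hV.measurable.indicator
      measurableSet_Ioo)), ae_restrict_mem measurableSet_Ioo] with x h1 h2 h3
    rw [h1, h2, indicator_of_mem h3]
  · rw [singularPart_posDensity, Measure.coe_zero, Pi.zero_apply]
  · rw [singularPart_posDensity, Measure.coe_zero, Pi.zero_apply]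

lemma C1Bound.c1Rep {p a b A : ℝ} (hp : 1 < p) {U V u : ℝ → ℝ} (h : C1Bound p A U V)
    (hu : ∀ᵐ x ∂volume.restrict (Ioo a b), U x = u x) : C1Rep a b u U := by
  refine ⟨hu, ContDiff.contDiffOn (contDiff_one_iff_deriv.2
    ⟨fun x => (h.1 x).differentiableAt, ?_⟩)⟩
  rw [show deriv U = V from funext fun x => (h.1 x).deriv]
  exact h.2.continuous hp

/-- A bound on the relaxed functional yields approximations of bounded energy. -/
lemma exists_tendstoL1_of_fpRel_le {ψ : ℝ → ℝ} {p a b : ℝ} {u : ℝ → ℝ} {C : ℝ≥0∞} (hC : C ≠ ⊤)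
    (h : FpRel ψ p a b u ≤ C) :
    ∃ U v w : ℕ → ℝ → ℝ, TendstoL1 a b U u ∧ ∀ k, W2pRep p a b (U k) (v k) (w k) ∧
      (∫ x in Ioo a b, |v k x|) + ∫ x in Ioo a b, ψ (v k x) * |w k x| ^ p ≤ C.toReal + 1 := by
  have hlt : FpRel ψ p a b u < ENNReal.ofReal (C.toReal + 1) := by
    refine h.trans_lt ?_
    rw [ENNReal.lt_ofReal_iff_toReal_lt hC]
    exact lt_add_one _
  simp only [FpRel, iInf_lt_iff] at hlt
  obtain ⟨U, ⟨hU1, hU2, hU3⟩, hlt⟩ := hlt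
  obtain ⟨e, he, hFe⟩ := extraction_of_frequently_atTop
    (frequently_lt_of_liminf_lt (by isBoundedDefault) hlt)
  simp only [Fp, iInf_lt_iff] at hFe
  choose v w hvw hle using hFe
  exact ⟨fun k => U (e k), v, w, ⟨fun k => hU1 _, hU2, hU3.comp he.tendsto_atTop⟩,
    fun k => ⟨hvw k, ((ENNReal.ofReal_lt_ofReal_iff (by positivity)).1 (hle k)).le⟩⟩

lemma W2pRep.abs_sub_le {p a b : ℝ} {U v w : ℝ → ℝ} (h : W2pRep p a b U v w) {x y : ℝ}
    (hx : x ∈ Ioo a b) (hy : y ∈ Ioo a b) : |U y - U x| ≤ ∫ t in Ioo a b, |v t| := by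
  have hsub := Set.ordConnected_Ioo.uIcc_subset hx hy
  have hi : IntervalIntegrable v volume x y :=
    intervalIntegrable_iff.2 (h.2.2.2.1.mono_set (uIoc_subset_uIcc.trans hsub))
  rw [← intervalIntegral.integral_eq_sub_of_hasDerivAt (fun t ht => h.1 t (hsub ht)) hi]
  exact (intervalIntegral.norm_integral_le_integral_norm_uIoc (f := v)).trans
    (setIntegral_mono_set h.2.2.2.1.abs (ae_of_all _ fun _ => abs_nonneg _)
      (Eventually.of_forall (uIoc_subset_uIcc.trans hsub)))

/-- An `L¹` limit of functions of oscillation at most `B` is essentially bounded. -/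
lemma TendstoL1.exists_ae_abs_le {a b B : ℝ} (hab : a < b) {U : ℕ → ℝ → ℝ} {u : ℝ → ℝ}
    (h : TendstoL1 a b U u)
    (hosc : ∀ k, ∀ x ∈ Ioo a b, ∀ y ∈ Ioo a b, |U k y - U k x| ≤ B) :
    ∃ M, ∀ᵐ x ∂volume.restrict (Ioo a b), |u x| ≤ M := by
  obtain ⟨hUi, hu, hlim⟩ := h
  have hba : 0 < b - a := sub_pos.2 hab
  set M := B + ((∫ x in Ioo a b, |u x|) + 1) / (b - a) with hM
  have hd : ∀ k, IntegrableOn (fun x => |U k x - u x|) (Ioo a b) := fun k =>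
    ((hUi k).sub hu).abs
  have hUM : ∀ k, ∫ x in Ioo a b, |U k x - u x| < 1 → ∀ x ∈ Ioo a b, |U k x| ≤ M := by
    intro k hk x hx
    have h1 : ∫ _ in Ioo a b, |U k x| ≤
        ∫ y in Ioo a b, ((|U k y - u y| + |u y|) + B) := by
      refine setIntegral_mono_on (integrable_const _)
        (((hd k).add hu.abs).add (integrable_const _)) measurableSet_Ioo fun y hy => ?_
      have h2 := abs_sub_abs_le_abs_sub (U k x) (U k y)
      have h3 := abs_sub_abs_le_abs_sub (U k y) (u y)
      have h4 := hosc k y hy x hx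
      linarith
    rw [integral_add (f := fun y => |U k y - u y| + |u y|) ((hd k).add hu.abs)
      (integrable_const _), integral_add (hd k) hu.abs,
      setIntegral_const, setIntegral_const, smul_eq_mul, smul_eq_mul,
      Real.volume_real_Ioo_of_le hab.le] at h1
    rw [hM, ← sub_le_iff_le_add', le_div_iff₀ hba]
    linarith
  have hi : IntegrableOn (fun x => max (|u x| - M) 0) (Ioo a b) :=
    (hu.abs.sub (integrable_const M)).pos_part
  have hzero : ∫ x in Ioo a b, max (|u x| - M) 0 ≤ 0 := by
    refine ge_of_tendsto hlim ?_
    filter_upwards [hlim.eventually_lt_const one_pos] with k hk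
    refine setIntegral_mono_on hi (hd k) measurableSet_Ioo fun x hx => ?_
    have h1 := hUM k hk x hx
    have h2 := abs_sub_abs_le_abs_sub (u x) (U k x)
    rw [abs_sub_comm] at h2
    exact max_le (by linarith) (abs_nonneg _)
  have h0 := (integral_eq_zero_iff_of_nonneg (fun x => le_max_right _ _) hi).1
    (le_antisymm hzero (integral_nonneg fun x => le_max_right _ _))
  refine ⟨M, ?_⟩
  filter_upwards [h0] with x hx
  exact sub_nonpos.1 ((le_max_left _ _).trans hx.le)

/-- On a finite measure space, convergence to zero in `L²` implies convergence in `L¹`. -/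
lemma tendsto_integral_abs_of_sq {α : Type*} [MeasurableSpace α] {μ : Measure α}
    [IsFiniteMeasure μ] {f : ℕ → α → ℝ} (hf : ∀ n, Integrable (f n) μ)
    (hf2 : ∀ n, Integrable (fun x => f n x ^ 2) μ)
    (h : Tendsto (fun n => ∫ x, f n x ^ 2 ∂μ) atTop (𝓝 0)) :
    Tendsto (fun n => ∫ x, |f n x| ∂μ) atTop (𝓝 0) := by
  refine squeeze_zero (fun n => integral_nonneg fun _ => abs_nonneg _) (fun n => ?_)
    (g := fun n => √(∫ x, f n x ^ 2 ∂μ) * √(μ.real univ)) ?_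
  · have h2 : MemLp (fun x => |f n x|) (ENNReal.ofReal 2) μ := by
      rw [ENNReal.ofReal_ofNat]
      exact ((memLp_two_iff_integrable_sq (hf n).1).2 (hf2 n)).abs
    have := integral_mul_le_Lp_mul_Lq_of_nonneg (μ := μ) Real.HolderConjugate.two_two
      (f := fun x => |f n x|) (g := fun _ => 1) (ae_of_all _ fun _ => abs_nonneg _)
      (ae_of_all _ fun _ => zero_le_one) h2 (memLp_const 1)
    simpa [Real.sqrt_eq_rpow] using this
  · simpa using (h.sqrt.mul_const _)

/-- if `u_n ∈ X^p_ψ(]a,b[)` have bounded relaxed energies and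
`u_n → g` in `L²` with `g` Lipschitz, then `g ∈ C¹([a,b]) ∩ X^p_ψ(]a,b[)`,
the `u_n` are eventually `C¹([a,b])`, and `u_n → g` in `C¹([a,b])`. -/
theorem statement_16 (a b p : ℝ) (hab : a < b) (hp : 1 < p)
    (ψ : ℝ → ℝ) (hψ : PsiHypP ψ p)
    (g : ℝ → ℝ) (hg : ∃ K : ℝ≥0, LipschitzOnWith K g (Set.Icc a b))
    (u : ℕ → ℝ → ℝ)
    (hX : ∀ n, ∃ μp μn : Measure ℝ, MemXp ψ p a b (u n) μp μn)
    (hE : ∃ C : ℝ≥0∞, C ≠ ⊤ ∧ ∀ n, FpRel ψ p a b (u n) ≤ C)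
    (hL2 : Tendsto (fun n => ∫ x in Set.Ioo a b, (u n x - g x) ^ 2) atTop (𝓝 0)) :
    (∃ μp μn : Measure ℝ, MemXp ψ p a b g μp μn) ∧
    ∃ (N : ℕ) (ubar : ℕ → ℝ → ℝ) (gbar : ℝ → ℝ),
      C1Rep a b g gbar ∧
      (∀ n ≥ N, C1Rep a b (u n) (ubar n)) ∧
      ∀ ε : ℝ, 0 < ε → ∃ N' : ℕ, ∀ n ≥ N', ∀ x ∈ Set.Icc a b,
        |ubar n x - gbar x| ≤ ε ∧
        |derivWithin (ubar n) (Set.Icc a b) x - derivWithin gbar (Set.Icc a b) x| ≤ ε := by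
  obtain ⟨K, hK⟩ := hg
  obtain ⟨C, hC, hE⟩ := hE
  have hgK : ∀ s ∈ Icc a b, ∀ t ∈ Icc a b, |g t - g s| ≤ K * |t - s| := fun s hs t ht =>
    hK.dist_le_mul t ht s hs
  have hgc := hK.continuousOn
  have hgi : IntegrableOn g (Ioo a b) := hgc.integrableOn_Icc.mono_set Ioo_subset_Icc_self
  choose U v w hUu hrep using fun n => exists_tendstoL1_of_fpRel_le hC (hE n)
  have hv0 : ∀ n k, 0 ≤ ∫ x in Ioo a b, |v n k x| := fun n k =>
    integral_nonneg fun _ => abs_nonneg _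
  have hw0 : ∀ n k, 0 ≤ ∫ x in Ioo a b, ψ (v n k x) * |w n k x| ^ p := fun n k =>
    integral_nonneg fun x => mul_nonneg (hψ.pos _).le (Real.rpow_nonneg (abs_nonneg _) _)
  have hui : ∀ n, IntegrableOn (u n) (Ioo a b) := fun n => (hUu n).2.1
  have hdi : ∀ n, IntegrableOn (fun x => u n x - g x) (Ioo a b) := fun n => (hui n).sub hgi
  have hL1 : Tendsto (fun n => ∫ x in Ioo a b, |u n x - g x|) atTop (𝓝 0) := by
    refine tendsto_integral_abs_of_sq hdi (fun n => ?_) hL2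
    obtain ⟨M, hM⟩ := (hUu n).exists_ae_abs_le (B := C.toReal + 1) hab fun k x hx y hy =>
      ((hrep n k).1.abs_sub_le hx hy).trans (by linarith [(hrep n k).2, hw0 n k])
    obtain ⟨G, hG⟩ := isCompact_Icc.exists_bound_of_continuousOn hgc
    simp only [sq]
    refine (hdi n).mul_bdd (c := M + G) (hdi n).1 ?_
    filter_upwards [hM, ae_restrict_mem measurableSet_Ioo] with x hx hxI
    exact (norm_sub_le _ _).trans (add_le_add hx (hG x (Ioo_subset_Icc_self hxI)))
  obtain ⟨η, hη, A, H⟩ := exists_integral_rpow_le_of_close (B := C.toReal + 1) hab hp K.2 hψ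
  obtain ⟨N, hN⟩ := eventually_atTop.1 (hL1.eventually_lt_const (half_pos hη))
  have key : ∀ n ≥ N, ∃ U' V', C1Bound p A U' V' ∧
      ∀ᵐ x ∂volume.restrict (Ioo a b), U' x = u n x := fun n hn => by
    obtain ⟨k₀, hk₀⟩ := eventually_atTop.1 ((hUu n).2.2.eventually_lt_const (half_pos hη))
    have hUV : ∀ j, ∃ U' V', C1Bound p A U' V' ∧ EqOn U' (U n (j + k₀)) (Ioo a b) := fun j => by
      refine (hrep n (j + k₀)).1.exists_c1Bound hab hp (H _ _ _ g (hrep n (j + k₀)).1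
        (by linarith [(hrep n (j + k₀)).2, hv0 n (j + k₀)]) hgK hgc ?_)
      have hUi := (hUu n).1 (j + k₀)
      have h1 : ∫ x in Ioo a b, |U n (j + k₀) x - g x| ≤
          ∫ x in Ioo a b, (|U n (j + k₀) x - u n x| + |u n x - g x|) :=
        integral_mono (hUi.sub hgi).abs ((hUi.sub (hui n)).abs.add (hdi n).abs)
          fun x => abs_sub_le _ _ _
      rw [integral_add (f := fun x => |U n (j + k₀) x - u n x|) (hUi.sub (hui n)).abs
        (hdi n).abs] at h1
      linarith [hk₀ (j + k₀) (Nat.le_add_left _ _), hN n hn]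
    choose U' V' hUV' hEq using hUV
    obtain ⟨U₀, V₀, h1, h2, -⟩ := C1Bound.exists_limit hab hp hUV' (hui n) <|
      ((tendsto_add_atTop_iff_nat k₀).2 (hUu n).2.2).congr fun j =>
        setIntegral_congr_fun measurableSet_Ioo fun x hx => by rw [hEq j hx]
    exact ⟨U₀, V₀, h1, h2⟩
  choose! ubar vbar hbar hbaru using key
  obtain ⟨gbar, dgbar, hgbar, hgbarg, hlim⟩ := C1Bound.exists_limit hab hp
    (fun n => hbar (n + N) (Nat.le_add_left _ _)) hgi <|
    ((tendsto_add_atTop_iff_nat N).2 hL1).congr fun n => integral_congr_ae <| by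
      filter_upwards [hbaru (n + N) (Nat.le_add_left _ _)] with x hx
      rw [hx]
  refine ⟨hgbar.memXp hab hp hψ hgbarg, N, ubar, gbar, hgbar.c1Rep hp hgbarg,
    fun n hn => (hbar n hn).c1Rep hp (hbaru n hn), fun ε hε => ?_⟩
  obtain ⟨N', hN'⟩ := hlim ε hε
  refine ⟨N' + N, fun n hn x hx => ?_⟩
  have hNn : N ≤ n := (Nat.le_add_left _ _).trans hn
  have huniq := uniqueDiffOn_Icc hab x hx
  rw [((hbar n hNn).1 x).hasDerivWithinAt.derivWithin huniq,
    (hgbar.1 x).hasDerivWithinAt.derivWithin huniq]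
  simpa only [Nat.sub_add_cancel hNn] using hN' (n - N) (Nat.le_sub_of_add_le hn) x hx
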